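/- For natural numbers k, m with m ≤ k, the quantity ∑_t C(k, m+2t)·(C(m+2t, t) − C(m+2t, t−1)) counts the Motzkin paths of length k ending at height m; summing the squares of these quantities over all 0 ≤ m ≤ k gives the number M_k of pairs, i.e., ∑_{m=0}^k (∑_t C(k,m+2t)(C(m+2t,t)−C(m+2t,t−1)))^2 equals the k-th term of the Motzkin sum sequence ∑_{m} (w_{k,m})^2 where w_{k,m} is the number of Motzkin paths of length k from height 0 to height m. -/

import Mathlib

/-- The number of Motzkin paths of length `k` from height `0` to height `m`: lattice
paths with steps `+1`, `-1`, `0`, staying nonnegative (heights are naturals). -/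
noncomputable def motzkinCount (k m : ℕ) : ℕ :=
  Nat.card {p : Fin (k + 1) → ℕ //
    p 0 = 0 ∧ p (Fin.last k) = m ∧
    ∀ i : Fin k, p i.succ = p i.castSucc + 1 ∨ p i.castSucc = p i.succ + 1 ∨
      p i.succ = p i.castSucc}

/-- The Motzkin paths of length `k` from height `0` to height `m`. -/
abbrev MotzkinPath (k m : ℕ) : Type :=
  {p : Fin (k + 1) → ℕ //
    p 0 = 0 ∧ p (Fin.last k) = m ∧
    ∀ i : Fin k, p i.succ = p i.castSucc + 1 ∨ p i.castSucc = p i.succ + 1 ∨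
      p i.succ = p i.castSucc}

/-- Removing the last step of a Motzkin path ending at `m` leaves a Motzkin path ending at one of
the heights from which `m` can be reached in one step. -/
def motzkinPathSuccEquiv (k m : ℕ) (s : Finset ℕ)
    (hs : ∀ j, j ∈ s ↔ m = j + 1 ∨ j = m + 1 ∨ m = j) :
    MotzkinPath (k + 1) m ≃ Σ j : s, MotzkinPath k j where
  toFun p := ⟨⟨p.1 (Fin.last k).castSucc, (hs _).2 (by
      have h := p.2.2.2 (Fin.last k)
      rwa [Fin.succ_last, p.2.2.1] at h)⟩,
    fun i => p.1 i.castSucc, p.2.1, rfl, fun i => p.2.2.2 i.castSucc⟩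
  invFun q := ⟨Fin.snoc (α := fun _ => ℕ) q.2.1 m, by
    obtain ⟨⟨j, hj⟩, q, h0, hl, hq⟩ := q
    refine ⟨?_, Fin.snoc_last _ _, fun i => ?_⟩
    · exact (Fin.snoc_castSucc (α := fun _ => ℕ) m q 0).trans h0
    · induction i using Fin.lastCases with
      | last =>
        rw [Fin.succ_last, Fin.snoc_last, Fin.snoc_castSucc]
        exact (hs (q (Fin.last k))).1 (Set.mem_of_eq_of_mem (s := (s : Set ℕ)) hl hj)
      | cast i =>
        rw [← Fin.castSucc_succ, Fin.snoc_castSucc, Fin.snoc_castSucc]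
        exact hq i⟩
  left_inv p := by
    apply Subtype.ext
    funext i
    induction i using Fin.lastCases with
    | last => simp [p.2.2.1]
    | cast i => simp
  right_inv q := by
    refine Sigma.subtype_ext (Subtype.ext ?_) (funext fun i => ?_)
    · simp [q.2.2.2.1]
    · simp

instance subsingleton_motzkinPath_zero (m : ℕ) : Subsingleton (MotzkinPath 0 m) :=
  ⟨fun p q => Subtype.ext <| funext fun i => by
    rw [Fin.fin_one_eq_zero i]
    exact p.2.1.trans q.2.1.symm⟩

instance finite_motzkinPath (k m : ℕ) : Finite (MotzkinPath k m) := by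
  induction k generalizing m with
  | zero => infer_instance
  | succ k ih =>
    exact Finite.of_equiv _ (motzkinPathSuccEquiv k m
      ((Finset.range (m + 2)).filter fun j => m = j + 1 ∨ j = m + 1 ∨ m = j) (fun j => by
        simp only [Finset.mem_filter, Finset.mem_range]; omega)).symm

theorem motzkinCount_succ (k m : ℕ) (s : Finset ℕ)
    (hs : ∀ j, j ∈ s ↔ m = j + 1 ∨ j = m + 1 ∨ m = j) :
    motzkinCount (k + 1) m = ∑ j ∈ s, motzkinCount k j := by
  rw [motzkinCount, Nat.card_congr (motzkinPathSuccEquiv k m s hs), Nat.card_sigma]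
  exact Finset.sum_coe_sort s (motzkinCount k)

theorem motzkinCount_succ_zero (k : ℕ) :
    motzkinCount (k + 1) 0 = motzkinCount k 0 + motzkinCount k 1 := by
  rw [motzkinCount_succ k 0 {0, 1} (fun j => by simp; omega), Finset.sum_pair zero_ne_one]

theorem motzkinCount_succ_succ (k m : ℕ) :
    motzkinCount (k + 1) (m + 1) =
      motzkinCount k m + motzkinCount k (m + 1) + motzkinCount k (m + 2) := by
  rw [motzkinCount_succ k (m + 1) {m, m + 1, m + 2} (fun j => by simp; omega),
    Finset.sum_insert (by simp), Finset.sum_pair (by simp), add_assoc]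

theorem motzkinCount_zero_zero : motzkinCount 0 0 = 1 := by
  rw [motzkinCount, Nat.card_eq_one_iff_unique]
  exact ⟨subsingleton_motzkinPath_zero 0, ⟨⟨fun _ => 0, rfl, rfl, fun i => i.elim0⟩⟩⟩

theorem motzkinCount_zero_succ (m : ℕ) : motzkinCount 0 (m + 1) = 0 := by
  have : IsEmpty (MotzkinPath 0 (m + 1)) := ⟨fun p =>
    m.succ_ne_zero (p.2.2.1.symm.trans p.2.1)⟩
  exact Nat.card_of_isEmpty

/-- The ballot number `C(m+2t,t) - C(m+2t,t-1)`, counting the nonnegative paths from `0` to `m`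
with `m + t` up-steps and `t` down-steps. -/
def ballotNumber (m t : ℕ) : ℕ :=
  (m + 2 * t).choose t - if t = 0 then 0 else (m + 2 * t).choose (t - 1)

theorem ballotNumber_zero_right (m : ℕ) : ballotNumber m 0 = 1 := by
  simp [ballotNumber]

theorem ballotNumber_succ_add (m t : ℕ) :
    ballotNumber m (t + 1) + (m + 2 * t + 2).choose t = (m + 2 * t + 2).choose (t + 1) := by
  have h : (m + 2 * t + 2).choose t ≤ (m + 2 * t + 2).choose (t + 1) :=
    Nat.choose_le_succ_of_lt_half_left (by omega)
  simp only [ballotNumber, Nat.add_one_ne_zero, if_false, Nat.add_sub_cancel]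
  rw [show m + 2 * (t + 1) = m + 2 * t + 2 by ring]
  omega

theorem ballotNumber_zero_succ (t : ℕ) : ballotNumber 0 (t + 1) = ballotNumber 1 t := by
  cases t with
  | zero => decide
  | succ t =>
    have h₀ := ballotNumber_succ_add 0 (t + 1)
    have h₁ := ballotNumber_succ_add 1 t
    have hs : (2 * t + 3).choose (t + 2) = (2 * t + 3).choose (t + 1) :=
      Nat.choose_symm_of_eq_add (by ring)
    rw [show 0 + 2 * (t + 1) + 2 = (2 * t + 3) + 1 by ring, Nat.choose_succ_succ' _ t,
      Nat.choose_succ_succ' _ (t + 1), hs] at h₀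
    rw [show 1 + 2 * t + 2 = 2 * t + 3 by ring] at h₁
    omega

theorem ballotNumber_succ_succ (m t : ℕ) :
    ballotNumber (m + 1) (t + 1) = ballotNumber m (t + 1) + ballotNumber (m + 2) t := by
  have h₀ := ballotNumber_succ_add (m + 1) t
  have h₁ := ballotNumber_succ_add m t
  rw [show m + 1 + 2 * t + 2 = (m + 2 * t + 2) + 1 by ring, Nat.choose_succ_succ'] at h₀
  cases t with
  | zero =>
    simp only [ballotNumber_zero_right, Nat.choose_zero_right] at *
    omega
  | succ t =>
    have h₂ := ballotNumber_succ_add (m + 2) t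
    rw [Nat.choose_succ_succ'] at h₀
    rw [show m + 2 + 2 * t + 2 = m + 2 * (t + 1) + 2 by ring] at h₂
    omega

theorem sum_choose_mul_ballotNumber_shift {N k : ℕ} (hk : k < N) (m : ℕ) :
    ∑ t ∈ Finset.range N, k.choose (m + 2 * (t + 1)) * ballotNumber (m + 2) t =
      ∑ t ∈ Finset.range (N + 1), k.choose (m + 2 + 2 * t) * ballotNumber (m + 2) t := by
  rw [Finset.sum_range_succ, Nat.choose_eq_zero_of_lt (by omega : k < m + 2 + 2 * N), zero_mul,
    add_zero]
  exact Finset.sum_congr rfl fun t _ => by rw [show m + 2 * (t + 1) = m + 2 + 2 * t by ring]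

theorem sum_choose_mul_ballotNumber {N k : ℕ} (hk : k ≤ N) (m : ℕ) :
    ∑ t ∈ Finset.range (N + 1), k.choose (m + 2 * t) * ballotNumber m t = motzkinCount k m := by
  induction k generalizing m with
  | zero =>
    rw [Finset.sum_range_succ']
    cases m with
    | zero => simp [motzkinCount_zero_zero, ballotNumber_zero_right, mul_add]
    | succ m => simp [motzkinCount_zero_succ, mul_add, add_right_comm _ 1]
  | succ k ih =>
    have ih := fun m => ih (by omega) m
    cases m with
    | zero =>
      rw [motzkinCount_succ_zero, ← ih 0, ← ih 1, Finset.sum_range_succ',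
        Finset.sum_range_succ' (fun t => k.choose (0 + 2 * t) * _),
        Finset.sum_range_succ (fun t => k.choose (1 + 2 * t) * _),
        Nat.choose_eq_zero_of_lt (by omega : k < 1 + 2 * N)]
      have h : ∀ t, (k + 1).choose (0 + 2 * (t + 1)) * ballotNumber 0 (t + 1) =
          k.choose (0 + 2 * (t + 1)) * ballotNumber 0 (t + 1) +
            k.choose (1 + 2 * t) * ballotNumber 1 t := fun t => by
        rw [← ballotNumber_zero_succ, show 0 + 2 * (t + 1) = (1 + 2 * t) + 1 by ring,
          Nat.choose_succ_succ']
        ring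
      simp only [h, Finset.sum_add_distrib, mul_zero, add_zero, Nat.choose_zero_right]
      ring
    | succ m =>
      have h : ∀ t, (k + 1).choose (m + 1 + 2 * t) * ballotNumber (m + 1) t =
          k.choose (m + 2 * t) * ballotNumber (m + 1) t +
            k.choose (m + 1 + 2 * t) * ballotNumber (m + 1) t := fun t => by
        rw [show m + 1 + 2 * t = (m + 2 * t) + 1 by ring, Nat.choose_succ_succ']
        ring
      simp only [h, Finset.sum_add_distrib]
      rw [motzkinCount_succ_succ, ← ih m, ← ih (m + 1), ← ih (m + 2),
        ← sum_choose_mul_ballotNumber_shift (by omega),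
        Finset.sum_range_succ' (fun t => k.choose (m + 2 * t) * ballotNumber (m + 1) t),
        Finset.sum_range_succ' (fun t => k.choose (m + 2 * t) * ballotNumber m t)]
      simp only [ballotNumber_succ_succ, mul_add, Finset.sum_add_distrib, ballotNumber_zero_right]
      ring

/-- `∑_t C(k,m+2t)(C(m+2t,t) - C(m+2t,t-1))` (with `C(⬝,-1) = 0`) counts Motzkin paths
of length `k` ending at height `m`, and summing the squares over `0 ≤ m ≤ k` gives
`∑_m w_{k,m}²`. -/
theorem motzkin_path_count (k m : ℕ) (hm : m ≤ k) :
    (∑ t ∈ Finset.range (k + 1),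
        k.choose (m + 2 * t) *
          ((m + 2 * t).choose t - if t = 0 then 0 else (m + 2 * t).choose (t - 1))) =
      motzkinCount k m ∧
    ∑ m ∈ Finset.range (k + 1),
        (∑ t ∈ Finset.range (k + 1),
          k.choose (m + 2 * t) *
            ((m + 2 * t).choose t - if t = 0 then 0 else (m + 2 * t).choose (t - 1))) ^ 2 =
      ∑ m ∈ Finset.range (k + 1), (motzkinCount k m) ^ 2 := by
  exact ⟨sum_choose_mul_ballotNumber le_rfl m,
    Finset.sum_congr rfl fun j _ => congrArg (· ^ 2) (sum_choose_mul_ballotNumber le_rfl j)⟩
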